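/- For all 1 ≤ i ≤ j ≤ n the following decompositions exist and are unique. (a) If j < n, then for every −(j+1) ≤ s ≤ j there exist unique elements E_{i,j}^{↑s_−}, E_{i,j}^{↑s_+} ∈ 𝒟_n with E_{i,j} = E_{i,j}^{↑s_−} + E_{i,j}^{↑s_+} and w_{j+1}^s E_{i,j}^{↑s_±} = q^{±1} E_{i,j}^{↑s_±} w_{j+1}^s. (b) If i > 1, then for every −(i−1) ≤ r ≤ i−2 there exist unique E_{i,j}^{↓r_−}, E_{i,j}^{↓r_+} with E_{i,j} = E_{i,j}^{↓r_−} + E_{i,j}^{↓r_+} and w_{i−1}^r E_{i,j}^{↓r_±} = q^{±1} E_{i,j}^{↓r_±} w_{i−1}^r. (c) If j < n, then for every −θ(j+1) ≤ s ≤ θ(j+1)−1 there exist unique F_{i,j}^{↑s_−}, F_{i,j}^{↑s_+} with F_{i,j} = F_{i,j}^{↑s_−} + F_{i,j}^{↑s_+} and m_{θ(j+1)}^s F_{i,j}^{↑s_±} = q^{±1} F_{i,j}^{↑s_±} m_{θ(j+1)}^s. (d) If i > 1, then for every −θ(i−1) ≤ r ≤ θ(i−1)−1 there exist unique F_{i,j}^{↓r_−},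 F_{i,j}^{↓r_+} with F_{i,j} = F_{i,j}^{↓r_−} + F_{i,j}^{↓r_+} and m_{θ(i−1)}^r F_{i,j}^{↓r_±} = q^{±1} F_{i,j}^{↓r_±} m_{θ(i−1)}^r. -/

import Mathlib

noncomputable section

/-- The ground field `𝕂 = ℂ(q)`, the field of rational functions over `ℂ`. -/
abbrev Kq : Type := RatFunc ℂ

/-- The formal variable `q ∈ ℂ(q)`. -/
def qq : Kq := RatFunc.X

/-- `𝐢 = √−1 ∈ ℂ`, viewed as a constant in `𝕂 = ℂ(q)`. -/
def ii : Kq := RatFunc.C Complex.I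

/-- `θ(i) = n + 1 − i`. -/
def th (n : ℕ) (i : ℤ) : ℤ := (n : ℤ) + 1 - i

/-- Labels for the vertices of the `𝒟ₙ`-quiver: `V i r` stands for `V_{i,r}`
(the canonical labels), and `C i` stands for the central vertex `Λ_{i,0}`. -/
inductive DnLabel : Type
  | V : ℤ → ℤ → DnLabel
  | C : ℤ → DnLabel
deriving DecidableEq

/-- Validity of a label for given rank `n`: `V i r` requires `1 ≤ i ≤ n`, `−i ≤ r ≤ i`;
`C i` requires `1 ≤ i ≤ n`.  There are `n² + 3n` valid labels. -/
def DnLabel.valid (n : ℕ) : DnLabel → Prop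
  | .V i r => 1 ≤ i ∧ i ≤ (n : ℤ) ∧ -i ≤ r ∧ r ≤ i
  | .C i => 1 ≤ i ∧ i ≤ (n : ℤ)

instance (n : ℕ) (v : DnLabel) : Decidable (v.valid n) := by
  cases v <;> unfold DnLabel.valid <;> infer_instance

/-- The vertex set of the `𝒟ₙ`-quiver. -/
def DnVertex (n : ℕ) := {v : DnLabel // v.valid n}

/-- The canonical label of the vertex `Λ_{i,r}`, using the identifications
`Λ_{a,b} = V_{θ(b),−θ(a)}` for `b > 0` and `Λ_{a,b} = V_{θ(−b),θ(a)}` for `b < 0`. -/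
def Lam (n : ℕ) (i r : ℤ) : DnLabel :=
  if 0 < r then .V (th n r) (-(th n i))
  else if r < 0 then .V (th n (-r)) (th n i)
  else .C i

/-- The list of arrows `(source, target, doubled weight)` of the `𝒟ₙ`-quiver, obtained by
amalgamating two copies of the Fock–Goncharov `(n+1)`-triangle quiver along two pairs of
sides.  Solid (weight `1`) arrows get doubled weight `2`, dashed (weight `1/2`) arrows get
doubled weight `1`.  The families are: the horizontal `V_i`- and `Λ_i`-path arrows, the
dashed boundary arrows along the two frozen columns, and, for each `1 ≤ i < n`, the
oriented cycle `V_{i,0} → V_{i+1,−1} → ⋯ → V_{n,i−n} → Λ_{i,0} → V_{n,n−i} → ⋯ → V_{i+1,1} → V_{i,0}`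
through the central column. -/
def dnArrows (n : ℕ) : List (DnLabel × DnLabel × ℤ) :=
  ((List.range n).flatMap fun i0 =>
    (List.range (2 * i0 + 2)).map fun k =>
      (DnLabel.V ((i0 : ℤ) + 1) (-((i0 : ℤ) + 1) + k),
       DnLabel.V ((i0 : ℤ) + 1) (-((i0 : ℤ) + 1) + k + 1), 2))
  ++ ((List.range n).flatMap fun i0 =>
    (List.range (2 * i0 + 2)).map fun k =>
      (Lam n ((i0 : ℤ) + 1) (-((i0 : ℤ) + 1) + k),
       Lam n ((i0 : ℤ) + 1) (-((i0 : ℤ) + 1) + k + 1), 2))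
  ++ ((List.range (n - 1)).map fun i0 =>
      (DnLabel.V ((i0 : ℤ) + 1) (-((i0 : ℤ) + 1)),
       DnLabel.V ((i0 : ℤ) + 2) (-((i0 : ℤ) + 2)), 1))
  ++ ((List.range (n - 1)).map fun i0 =>
      (DnLabel.V ((i0 : ℤ) + 2) ((i0 : ℤ) + 2),
       DnLabel.V ((i0 : ℤ) + 1) ((i0 : ℤ) + 1), 1))
  ++ ((List.range (n - 1)).flatMap fun i0 =>
      (((List.range (n - 1 - i0)).map fun k =>
          (DnLabel.V ((i0 : ℤ) + 1 + k) (-(k : ℤ)),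
           DnLabel.V ((i0 : ℤ) + 2 + k) (-(k : ℤ) - 1), 2))
        ++ [(DnLabel.V (n : ℤ) ((i0 : ℤ) + 1 - n), DnLabel.C ((i0 : ℤ) + 1), 2),
            (DnLabel.C ((i0 : ℤ) + 1), DnLabel.V (n : ℤ) ((n : ℤ) - (i0 + 1)), 2)]
        ++ ((List.range (n - 1 - i0)).map fun k =>
          (DnLabel.V ((i0 : ℤ) + 2 + k) ((k : ℤ) + 1),
           DnLabel.V ((i0 : ℤ) + 1 + k) (k : ℤ), 2))))

/-- The doubled exchange matrix `2·ε_{uv}` of the `𝒟ₙ`-quiver. -/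
def eps2 (n : ℕ) (u v : DnLabel) : ℤ :=
  ((dnArrows n).map fun a =>
    (if a.1 = u ∧ a.2.1 = v then a.2.2 else 0)
      - (if a.1 = v ∧ a.2.1 = u then a.2.2 else 0)).sum

/-- The defining relations of the quantum torus algebra `𝒟ₙ`: generators `X_v^{±1}`
(`Sum.inl v` is `X_v`, `Sum.inr v` is `X_v⁻¹`) with `X_u X_v = q^{2 ε_{vu}} X_v X_u`. -/
inductive DnRel (n : ℕ) :
    FreeAlgebra Kq (DnVertex n ⊕ DnVertex n) →
      FreeAlgebra Kq (DnVertex n ⊕ DnVertex n) → Prop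
  | comm (u v : DnVertex n) :
      DnRel n (FreeAlgebra.ι Kq (Sum.inl u) * FreeAlgebra.ι Kq (Sum.inl v))
        ((qq ^ eps2 n v.1 u.1) • (FreeAlgebra.ι Kq (Sum.inl v) * FreeAlgebra.ι Kq (Sum.inl u)))
  | mul_inv (v : DnVertex n) :
      DnRel n (FreeAlgebra.ι Kq (Sum.inl v) * FreeAlgebra.ι Kq (Sum.inr v)) 1
  | inv_mul (v : DnVertex n) :
      DnRel n (FreeAlgebra.ι Kq (Sum.inr v) * FreeAlgebra.ι Kq (Sum.inl v)) 1

/-- The quantum torus algebra `𝒟ₙ`. -/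
abbrev Dtorus (n : ℕ) := RingQuot (DnRel n)

/-- The cluster variable `X_v ∈ 𝒟ₙ` attached to a label (junk value `1` on invalid labels). -/
def Xg (n : ℕ) (v : DnLabel) : Dtorus n :=
  if h : v.valid n then RingQuot.mkAlgHom Kq (DnRel n) (FreeAlgebra.ι Kq (Sum.inl ⟨v, h⟩)) else 1

/-- The inverse cluster variable `X_v⁻¹ ∈ 𝒟ₙ` (junk value `1` on invalid labels). -/
def Xinv (n : ℕ) (v : DnLabel) : Dtorus n :=
  if h : v.valid n then RingQuot.mkAlgHom Kq (DnRel n) (FreeAlgebra.ι Kq (Sum.inr ⟨v, h⟩)) else 1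

/-- The ordered product `X_{V_{i,−i}} X_{V_{i,1−i}} ⋯ X_{V_{i,r}}`. -/
def Vprod (n : ℕ) (i r : ℤ) : Dtorus n :=
  ((List.range (r + i + 1).toNat).map fun k => Xg n (.V i (-i + k))).prod

/-- The ordered product `X_{Λ_{i,−i}} X_{Λ_{i,1−i}} ⋯ X_{Λ_{i,r}}`. -/
def Lprod (n : ℕ) (i r : ℤ) : Dtorus n :=
  ((List.range (r + i + 1).toNat).map fun k => Xg n (Lam n i (-i + k))).prod

/-- `w_i^r = 𝐢 q^{i+r} X_{V_{i,−i}} X_{V_{i,1−i}} ⋯ X_{V_{i,r}}`. -/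
def ww (n : ℕ) (i r : ℤ) : Dtorus n := (ii * qq ^ (i + r)) • Vprod n i r

/-- `m_i^r = 𝐢 q^{i+r} X_{Λ_{i,−i}} X_{Λ_{i,1−i}} ⋯ X_{Λ_{i,r}}`. -/
def mm (n : ℕ) (i r : ℤ) : Dtorus n := (ii * qq ^ (i + r)) • Lprod n i r


/-- `E_i = Σ_{r=−i}^{i−1} w_i^r ∈ 𝒟ₙ`, the image of the Chevalley generator `E_i`. -/
def Ev (n : ℕ) (i : ℤ) : Dtorus n := ∑ r ∈ Finset.Icc (-i) (i - 1), ww n i r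

/-- `F_j = Σ_{r=−θ(j)}^{θ(j)−1} m_{θ(j)}^r ∈ 𝒟ₙ`, the image of the Chevalley generator `F_j`. -/
def Fv (n : ℕ) (j : ℤ) : Dtorus n :=
  ∑ r ∈ Finset.Icc (-(th n j)) (th n j - 1), mm n (th n j) r

/-- Auxiliary recursion: `EEaux n i k = E_{i,i+k}`. -/
def EEaux (n : ℕ) (i : ℤ) : ℕ → Dtorus n
  | 0 => Ev n i
  | k + 1 => (qq - qq⁻¹)⁻¹ •
      (EEaux n i k * Ev n (i + k + 1) - qq • (Ev n (i + k + 1) * EEaux n i k))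

/-- The quantum root vector `E_{i,j}`, defined by `E_{i,i} = E_i` and
`E_{i,j} = (E_{i,j−1}E_j − qE_jE_{i,j−1})/(q−q^{−1})`. -/
def EE (n : ℕ) (i j : ℤ) : Dtorus n := EEaux n i (j - i).toNat

/-- Auxiliary recursion: `FFaux n i k = F_{i,i+k}`. -/
def FFaux (n : ℕ) (i : ℤ) : ℕ → Dtorus n
  | 0 => Fv n i
  | k + 1 => (qq - qq⁻¹)⁻¹ •
      (Fv n (i + k + 1) * FFaux n i k - qq⁻¹ • (FFaux n i k * Fv n (i + k + 1)))

/-- The quantum root vector `F_{i,j}`, defined by `F_{i,i} = F_i` and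
`F_{i,j} = (F_jF_{i,j−1} − q^{−1}F_{i,j−1}F_j)/(q−q^{−1})`. -/
def FF (n : ℕ) (i j : ℤ) : Dtorus n := FFaux n i (j - i).toNat

/-- The total doubled weight of the arrows `u → v` in a list of arrows. -/
def arrowWeight (l : List (DnLabel × DnLabel × ℤ)) (u v : DnLabel) : ℤ :=
  (l.map fun a => if a.1 = u ∧ a.2.1 = v then a.2.2 else 0).sum

theorem eps2_eq_arrowWeight_sub (n : ℕ) (u v : DnLabel) :
    eps2 n u v = arrowWeight (dnArrows n) u v - arrowWeight (dnArrows n) v u := by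
  unfold eps2 arrowWeight
  induction dnArrows n with
  | nil => simp
  | cons a l ih => simp only [List.map_cons, List.sum_cons, ih]; ring

theorem arrowWeight_append (l l' : List (DnLabel × DnLabel × ℤ)) (u v : DnLabel) :
    arrowWeight (l ++ l') u v = arrowWeight l u v + arrowWeight l' u v := by
  simp [arrowWeight]

theorem arrowWeight_flatMap_append (l : List ℕ) (f g : ℕ → List (DnLabel × DnLabel × ℤ))
    (u v : DnLabel) :
    arrowWeight (l.flatMap fun i => f i ++ g i) u v
      = arrowWeight (l.flatMap f) u v + arrowWeight (l.flatMap g) u v := by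
  induction l with
  | nil => simp [arrowWeight]
  | cons a l ih => simp only [List.flatMap_cons, arrowWeight_append, ih]; ring

/-- A family of arrows of constant weight contributes that weight, provided that each arrow
occurs at most once in the family. -/
theorem arrowWeight_map_range (N : ℕ) (a b : ℕ → DnLabel) (w : ℤ) (u v : DnLabel)
    (huniq : ∀ i i', a i = u ∧ b i = v → a i' = u ∧ b i' = v → i = i') (c : Prop) [Decidable c]
    (hc : (∃ i < N, a i = u ∧ b i = v) ↔ c) :
    arrowWeight ((List.range N).map fun i => (a i, b i, w)) u v = if c then w else 0 := by
  simp only [← hc]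
  clear hc
  induction N with
  | zero => simp [arrowWeight]
  | succ N ih =>
    rw [List.range_succ, List.map_append, arrowWeight_append, ih]
    simp only [arrowWeight, List.map_cons, List.map_nil, List.sum_cons, List.sum_nil, add_zero]
    by_cases h : a N = u ∧ b N = v
    · have h1 : ¬ ∃ i < N, a i = u ∧ b i = v := by
        rintro ⟨i, hi, hi'⟩
        have := huniq _ _ h hi'
        omega
      rw [if_neg h1, if_pos h, if_pos ⟨N, by omega, h⟩, zero_add]
    · rw [if_neg h, add_zero]
      refine if_congr ⟨fun ⟨i, hi, h'⟩ => ⟨i, by omega, h'⟩, fun ⟨i, hi, h'⟩ => ⟨i, ?_, h'⟩⟩ rfl rfl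
      rcases Nat.lt_succ_iff_lt_or_eq.1 hi with h'' | rfl
      · exact h''
      · exact absurd h' h

theorem arrowWeight_flatMap_range (N : ℕ) (m : ℕ → ℕ) (a b : ℕ → ℕ → DnLabel) (w : ℤ)
    (u v : DnLabel)
    (huniq : ∀ i k i' k', a i k = u ∧ b i k = v → a i' k' = u ∧ b i' k' = v → i = i' ∧ k = k')
    (c : Prop) [Decidable c] (hc : (∃ i < N, ∃ k < m i, a i k = u ∧ b i k = v) ↔ c) :
    arrowWeight ((List.range N).flatMap fun i => (List.range (m i)).map fun k =>
      (a i k, b i k, w)) u v = if c then w else 0 := by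
  classical
  simp only [← hc]
  clear hc
  induction N with
  | zero => simp [arrowWeight]
  | succ N ih =>
    rw [List.range_succ, List.flatMap_append, arrowWeight_append, ih, List.flatMap_singleton,
      arrowWeight_map_range _ _ _ _ _ _ (fun k k' h h' => (huniq _ _ _ _ h h').2) _ Iff.rfl]
    by_cases h : ∃ k < m N, a N k = u ∧ b N k = v
    · have h1 : ¬ ∃ i < N, ∃ k < m i, a i k = u ∧ b i k = v := by
        rintro ⟨i, hi, k, -, hk⟩
        obtain ⟨k', -, hk'⟩ := h
        have := (huniq _ _ _ _ hk' hk).1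
        omega
      rw [if_neg h1, if_pos h, if_pos ⟨N, by omega, h⟩, zero_add]
    · rw [if_neg h, add_zero]
      refine if_congr ⟨fun ⟨i, hi, h'⟩ => ⟨i, by omega, h'⟩, fun ⟨i, hi, h'⟩ => ⟨i, ?_, h'⟩⟩ rfl rfl
      rcases Nat.lt_succ_iff_lt_or_eq.1 hi with h'' | rfl
      · exact h''
      · exact absurd h' h

theorem Lam_eq_V (n : ℕ) (a b i t : ℤ) :
    Lam n a b = .V i t ↔ (0 < b ∧ n + 1 - b = i ∧ a - n - 1 = t) ∨
      (b < 0 ∧ n + 1 + b = i ∧ n + 1 - a = t) := by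
  unfold Lam th
  split_ifs <;> simp only [DnLabel.V.injEq, false_iff] <;> omega

theorem Lam_eq_C (n : ℕ) (a b c : ℤ) : Lam n a b = .C c ↔ b = 0 ∧ a = c := by
  unfold Lam
  split_ifs <;> simp only [DnLabel.C.injEq, false_iff] <;> omega

theorem List.bind_pure_natCast (l : List ℕ) :
    (l >>= fun a => pure (a : ℤ)) = l.map (Nat.cast : ℕ → ℤ) := by
  simp [List.map_eq_flatMap]

theorem arrowWeight_map_eq_zero (N : ℕ) (a b : ℕ → DnLabel) (w : ℤ) (u v : DnLabel)
    (h : ∀ i, ¬ (a i = u ∧ b i = v)) :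
    arrowWeight ((List.range N).map fun i => (a i, b i, w)) u v = 0 := by
  rw [arrowWeight_map_range _ _ _ _ _ _ (fun i _ hi => absurd hi (h i)) False (by simp [h])]
  exact if_neg not_false

theorem arrowWeight_flatMap_eq_zero (N : ℕ) (m : ℕ → ℕ) (a b : ℕ → ℕ → DnLabel) (w : ℤ)
    (u v : DnLabel) (h : ∀ i k, ¬ (a i k = u ∧ b i k = v)) :
    arrowWeight ((List.range N).flatMap fun i => (List.range (m i)).map fun k =>
      (a i k, b i k, w)) u v = 0 := by
  rw [arrowWeight_flatMap_range _ _ _ _ _ _ _ (fun i k _ _ hi => absurd hi (h i k)) False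
    (by simp [h])]
  exact if_neg not_false

theorem arrowWeight_dnArrows (n : ℕ) (u v : DnLabel) :
    arrowWeight (dnArrows n) u v =
      arrowWeight ((List.range n).flatMap fun i0 : ℕ => (List.range (2 * i0 + 2)).map fun k : ℕ =>
        (DnLabel.V ((i0 : ℤ) + 1) (-((i0 : ℤ) + 1) + k),
         DnLabel.V ((i0 : ℤ) + 1) (-((i0 : ℤ) + 1) + k + 1), 2)) u v
      + arrowWeight ((List.range n).flatMap fun i0 : ℕ => (List.range (2 * i0 + 2)).map fun k : ℕ =>
        (Lam n ((i0 : ℤ) + 1) (-((i0 : ℤ) + 1) + k),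
         Lam n ((i0 : ℤ) + 1) (-((i0 : ℤ) + 1) + k + 1), 2)) u v
      + arrowWeight ((List.range (n - 1)).map fun i0 : ℕ =>
        (DnLabel.V ((i0 : ℤ) + 1) (-((i0 : ℤ) + 1)),
         DnLabel.V ((i0 : ℤ) + 2) (-((i0 : ℤ) + 2)), 1)) u v
      + arrowWeight ((List.range (n - 1)).map fun i0 : ℕ =>
        (DnLabel.V ((i0 : ℤ) + 2) ((i0 : ℤ) + 2),
         DnLabel.V ((i0 : ℤ) + 1) ((i0 : ℤ) + 1), 1)) u v
      + arrowWeight ((List.range (n - 1)).flatMap fun i0 : ℕ => (List.range (n - 1 - i0)).map fun k : ℕ =>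
        (DnLabel.V ((i0 : ℤ) + 1 + k) (-(k : ℤ)),
         DnLabel.V ((i0 : ℤ) + 2 + k) (-(k : ℤ) - 1), 2)) u v
      + arrowWeight ((List.range (n - 1)).map fun i0 : ℕ =>
        (DnLabel.V (n : ℤ) ((i0 : ℤ) + 1 - n), DnLabel.C ((i0 : ℤ) + 1), 2)) u v
      + arrowWeight ((List.range (n - 1)).map fun i0 : ℕ =>
        (DnLabel.C ((i0 : ℤ) + 1), DnLabel.V (n : ℤ) ((n : ℤ) - (i0 + 1)), 2)) u v
      + arrowWeight ((List.range (n - 1)).flatMap fun i0 : ℕ => (List.range (n - 1 - i0)).map fun k : ℕ =>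
        (DnLabel.V ((i0 : ℤ) + 2 + k) ((k : ℤ) + 1),
         DnLabel.V ((i0 : ℤ) + 1 + k) (k : ℤ), 2)) u v := by
  have h (l : List ℕ) (a b : ℕ → DnLabel × DnLabel × ℤ) :
      arrowWeight (l.flatMap fun i => [a i, b i]) u v
        = arrowWeight (l.map a) u v + arrowWeight (l.map b) u v := by
    induction l with
    | nil => simp [arrowWeight]
    | cons x l ih =>
      simp only [arrowWeight, List.map_cons, List.sum_cons, List.flatMap_cons, List.map_append,
        List.sum_append, List.map_nil, List.sum_nil] at ih ⊢
      rw [ih]; ring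
  simp only [dnArrows, List.bind_pure_natCast, List.map_map, Function.comp_def, arrowWeight_append,
    arrowWeight_flatMap_append, h]
  ring

theorem arrowWeight_V_V (n : ℕ) (i t j u : ℤ) :
    arrowWeight (dnArrows n) (.V i t) (.V j u) =
      (if j = i ∧ u = t + 1 ∧ 1 ≤ i ∧ i ≤ n ∧ -i ≤ t ∧ t < i then 2 else 0)
      + (if u = t ∧ ((1 ≤ t ∧ j = i + 1 ∧ t ≤ i ∧ i < n) ∨
          (t ≤ -1 ∧ j = i - 1 ∧ 1 ≤ -t ∧ -t < i ∧ i ≤ n)) then 2 else 0)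
      + (if t = -i ∧ j = i + 1 ∧ u = -j ∧ 1 ≤ i ∧ i < n then 1 else 0)
      + (if t = i ∧ j = i - 1 ∧ u = j ∧ 1 < i ∧ i ≤ n then 1 else 0)
      + (if j = i + 1 ∧ u = t - 1 ∧ t ≤ 0 ∧ -t < i ∧ i < n then 2 else 0)
      + (if j = i - 1 ∧ u = t - 1 ∧ 1 ≤ t ∧ t < i ∧ i ≤ n then 2 else 0) := by
  rw [arrowWeight_dnArrows]
  refine Eq.trans (b := _ + _ + _ + _ + _ + 0 + 0 + _) ?_
    (congrArg₂ (· + ·) ((add_zero _).trans (add_zero _)) rfl)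
  congr 1; congr 1; congr 1; congr 1; congr 1; congr 1; congr 1
  · refine arrowWeight_flatMap_range _ _ _ _ _ _ _ ?_ _ ?_ <;> simp only [DnLabel.V.injEq]
    · omega
    · constructor
      · rintro ⟨i0, _, k, _, _⟩; omega
      · intro h; exact ⟨(i - 1).toNat, by omega, (t + i).toNat, by omega, by omega⟩
  · refine arrowWeight_flatMap_range _ _ _ _ _ _ _ ?_ _ ?_ <;> simp only [Lam_eq_V]
    · omega
    · constructor
      · rintro ⟨i0, _, k, _, _⟩; omega
      · rintro ⟨h, h' | h'⟩
        · exact ⟨(n - t).toNat, by omega, (i - t).toNat, by omega, by omega⟩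
        · exact ⟨(n + t).toNat, by omega, (2 * n + 2 + t - i).toNat, by omega, by omega⟩
  · refine arrowWeight_map_range _ _ _ _ _ _ ?_ _ ?_ <;> simp only [DnLabel.V.injEq]
    · omega
    · constructor
      · rintro ⟨i0, _, _⟩; omega
      · intro h; exact ⟨(i - 1).toNat, by omega, by omega⟩
  · refine arrowWeight_map_range _ _ _ _ _ _ ?_ _ ?_ <;> simp only [DnLabel.V.injEq]
    · omega
    · constructor
      · rintro ⟨i0, _, _⟩; omega
      · intro h; exact ⟨(i - 2).toNat, by omega, by omega⟩
  · refine arrowWeight_flatMap_range _ _ _ _ _ _ _ ?_ _ ?_ <;> simp only [DnLabel.V.injEq]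
    · omega
    · constructor
      · rintro ⟨i0, _, k, _, _⟩; omega
      · intro h; exact ⟨(i + t - 1).toNat, by omega, (-t).toNat, by omega, by omega⟩
  · exact arrowWeight_map_eq_zero _ _ _ _ _ _ (by simp)
  · exact arrowWeight_map_eq_zero _ _ _ _ _ _ (by simp)
  · refine arrowWeight_flatMap_range _ _ _ _ _ _ _ ?_ _ ?_ <;> simp only [DnLabel.V.injEq]
    · omega
    · constructor
      · rintro ⟨i0, _, k, _, _⟩; omega
      · intro h; exact ⟨(i - t - 1).toNat, by omega, (t - 1).toNat, by omega, by omega⟩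

theorem arrowWeight_V_C (n : ℕ) (i t c : ℤ) :
    arrowWeight (dnArrows n) (.V i t) (.C c) =
      (if i = n ∧ t = n + 1 - c ∧ 1 ≤ c ∧ c ≤ n then 2 else 0)
      + (if i = n ∧ t = c - n ∧ 1 ≤ c ∧ c < n then 2 else 0) := by
  rw [arrowWeight_dnArrows]
  refine Eq.trans (b := 0 + _ + 0 + 0 + 0 + _ + 0 + 0) ?_
    ((add_zero _).trans ((add_zero _).trans (congrArg₂ (· + ·)
      ((add_zero _).trans ((add_zero _).trans ((add_zero _).trans (zero_add _)))) rfl)))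
  congr 1; congr 1; congr 1; congr 1; congr 1; congr 1; congr 1
  · exact arrowWeight_flatMap_eq_zero _ _ _ _ _ _ _ (by simp)
  · refine arrowWeight_flatMap_range _ _ _ _ _ _ _ ?_ _ ?_ <;> simp only [Lam_eq_V, Lam_eq_C]
    · omega
    · constructor
      · rintro ⟨i0, _, k, _, _⟩; omega
      · intro h; exact ⟨(c - 1).toNat, by omega, (c - 1).toNat, by omega, by omega⟩
  · exact arrowWeight_map_eq_zero _ _ _ _ _ _ (by simp)
  · exact arrowWeight_map_eq_zero _ _ _ _ _ _ (by simp)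
  · exact arrowWeight_flatMap_eq_zero _ _ _ _ _ _ _ (by simp)
  · refine arrowWeight_map_range _ _ _ _ _ _ ?_ _ ?_ <;> simp only [DnLabel.V.injEq, DnLabel.C.injEq]
    · omega
    · constructor
      · rintro ⟨i0, _, _⟩; omega
      · intro h; exact ⟨(c - 1).toNat, by omega, by omega⟩
  · exact arrowWeight_map_eq_zero _ _ _ _ _ _ (by simp)
  · exact arrowWeight_flatMap_eq_zero _ _ _ _ _ _ _ (by simp)

theorem arrowWeight_C_V (n : ℕ) (c j u : ℤ) :
    arrowWeight (dnArrows n) (.C c) (.V j u) =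
      (if j = n ∧ u = c - n - 1 ∧ 1 ≤ c ∧ c ≤ n then 2 else 0)
      + (if j = n ∧ u = n - c ∧ 1 ≤ c ∧ c < n then 2 else 0) := by
  rw [arrowWeight_dnArrows]
  refine Eq.trans (b := 0 + _ + 0 + 0 + 0 + 0 + _ + 0) ?_
    ((add_zero _).trans (congrArg₂ (· + ·) ((add_zero _).trans ((add_zero _).trans ((add_zero _).trans
      ((add_zero _).trans (zero_add _))))) rfl))
  congr 1; congr 1; congr 1; congr 1; congr 1; congr 1; congr 1
  · exact arrowWeight_flatMap_eq_zero _ _ _ _ _ _ _ (by simp)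
  · refine arrowWeight_flatMap_range _ _ _ _ _ _ _ ?_ _ ?_ <;> simp only [Lam_eq_V, Lam_eq_C]
    · omega
    · constructor
      · rintro ⟨i0, _, k, _, _⟩; omega
      · intro h; exact ⟨(c - 1).toNat, by omega, c.toNat, by omega, by omega⟩
  · exact arrowWeight_map_eq_zero _ _ _ _ _ _ (by simp)
  · exact arrowWeight_map_eq_zero _ _ _ _ _ _ (by simp)
  · exact arrowWeight_flatMap_eq_zero _ _ _ _ _ _ _ (by simp)
  · exact arrowWeight_map_eq_zero _ _ _ _ _ _ (by simp)
  · refine arrowWeight_map_range _ _ _ _ _ _ ?_ _ ?_ <;> simp only [DnLabel.V.injEq, DnLabel.C.injEq]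
    · omega
    · constructor
      · rintro ⟨i0, _, _⟩; omega
      · intro h; exact ⟨(c - 1).toNat, by omega, by omega⟩
  · exact arrowWeight_flatMap_eq_zero _ _ _ _ _ _ _ (by simp)

theorem arrowWeight_C_C (n : ℕ) (c d : ℤ) : arrowWeight (dnArrows n) (.C c) (.C d) = 0 := by
  rw [arrowWeight_dnArrows]
  refine Eq.trans (b := 0 + 0 + 0 + 0 + 0 + 0 + 0 + 0) ?_ (by simp only [add_zero])
  congr 1; congr 1; congr 1; congr 1; congr 1; congr 1; congr 1
  · exact arrowWeight_flatMap_eq_zero _ _ _ _ _ _ _ (by simp)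
  · exact arrowWeight_flatMap_eq_zero _ _ _ _ _ _ _ (by simp only [Lam_eq_C]; omega)
  · exact arrowWeight_map_eq_zero _ _ _ _ _ _ (by simp)
  · exact arrowWeight_map_eq_zero _ _ _ _ _ _ (by simp)
  · exact arrowWeight_flatMap_eq_zero _ _ _ _ _ _ _ (by simp)
  · exact arrowWeight_map_eq_zero _ _ _ _ _ _ (by simp)
  · exact arrowWeight_map_eq_zero _ _ _ _ _ _ (by simp)
  · exact arrowWeight_flatMap_eq_zero _ _ _ _ _ _ _ (by simp)

/-- The doubled exchange matrix entry between the `t`-th vertex of row `i` and the `u`-th vertex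
of row `i + 1`. -/
def rowEps (i t u : ℤ) : ℤ :=
  if u = t then (if 1 ≤ t then 2 else if t ≤ -1 then -2 else 0)
  else if u = t - 1 then (if t = -i then 1 else if t ≤ 0 then 2 else 0)
  else if u = t + 1 then (if t = i then -1 else if 0 ≤ t then -2 else 0)
  else 0

/-- The partial sums of `rowEps i` over the vertices up to position `r` in row `i` and
up to position `s` in row `i + 1`. -/
def rowSum (i r s : ℤ) : ℤ :=
  if r < -i ∨ s < -i - 1 then 0 else if s < 0 ∧ s < r ∨ 0 ≤ s ∧ s ≤ r then 1 else -1

theorem rowEps_eq (i t u : ℤ) (ht : -i ≤ t) (ht' : t < i) (hu : -i - 1 ≤ u) (hu' : u ≤ i) :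
    rowEps i t u = rowSum i t u - rowSum i (t - 1) u - rowSum i t (u - 1)
      + rowSum i (t - 1) (u - 1) := by
  unfold rowEps rowSum
  have h1 : u < t - 1 ∨ u = t - 1 ∨ u = t ∨ u = t + 1 ∨ t + 1 < u := by omega
  have h2 : t = -i ∨ -i < t := by omega
  have h3 : u = -i - 1 ∨ -i - 1 < u := by omega
  have h4 : t < 0 ∨ t = 0 ∨ 0 < t := by omega
  have h5 : u < 0 ∨ u = 0 ∨ 0 < u := by omega
  rcases h1 with h1 | h1 | h1 | h1 | h1 <;> rcases h2 with h2 | h2 <;> rcases h3 with h3 | h3 <;>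
    rcases h4 with h4 | h4 | h4 <;> rcases h5 with h5 | h5 | h5 <;> first | (exfalso; omega) |
    (simp (disch := omega) only [if_pos, if_neg]; rfl)

theorem eps2_V_V_succ (n : ℕ) (i t u : ℤ) (hi : 1 ≤ i) (hi' : i < n) (ht : -i ≤ t) (ht' : t ≤ i) :
    eps2 n (.V i t) (.V (i + 1) u) = rowEps i t u := by
  rw [eps2_eq_arrowWeight_sub, arrowWeight_V_V, arrowWeight_V_V]
  unfold rowEps
  have hu : u = t ∨ u = t - 1 ∨ u = t + 1 ∨ u ≠ t ∧ u ≠ t - 1 ∧ u ≠ t + 1 := by omega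
  have ht0 : t < 0 ∨ t = 0 ∨ 0 < t := lt_trichotomy t 0
  have hti : t = -i ∨ t = i ∨ -i < t ∧ t < i := by omega
  rcases hu with h | h | h | h <;> rcases ht0 with h0 | h0 | h0 <;>
    rcases hti with h' | h' | h' <;> first | (exfalso; omega) |
    simp (disch := omega) only [true_and, if_pos, if_neg, add_zero, zero_add, zero_sub, sub_zero]

theorem eps2_V_V_far (n : ℕ) (i j t u : ℤ) (hij : i + 1 < j) :
    eps2 n (.V i t) (.V j u) = 0 := by
  rw [eps2_eq_arrowWeight_sub, arrowWeight_V_V, arrowWeight_V_V]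
  simp (disch := omega) only [if_neg]
  rfl

theorem eps2_Lam_Lam_succ (n : ℕ) (i t u : ℤ) (hi : 1 ≤ i) (hi' : i < n) (ht : -i ≤ t)
    (ht' : t ≤ i) (hu : -i - 1 ≤ u) (hu' : u ≤ i + 1) :
    eps2 n (Lam n i t) (Lam n (i + 1) u) = rowEps i t u := by
  rw [eps2_eq_arrowWeight_sub]
  unfold rowEps Lam th
  have hu : u = t ∨ u = t - 1 ∨ u = t + 1 ∨ u ≠ t ∧ u ≠ t - 1 ∧ u ≠ t + 1 := by omega
  have hu0 : u < 0 ∨ u = 0 ∨ 0 < u := lt_trichotomy u 0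
  have ht0 : t < 0 ∨ t = 0 ∨ 0 < t := lt_trichotomy t 0
  have hti : t = -i ∨ t = i ∨ -i < t ∧ t < i := by omega
  rcases hu with h | h | h | h <;> rcases ht0 with h0 | h0 | h0 <;>
    rcases hu0 with h0' | h0' | h0' <;> rcases hti with h' | h' | h' <;> first | (exfalso; omega) |
    simp (disch := omega) only [if_pos, if_neg, arrowWeight_V_V, arrowWeight_V_C,
      arrowWeight_C_V, arrowWeight_C_C, add_zero, zero_add, zero_sub, sub_zero]

theorem eps2_Lam_Lam_far (n : ℕ) (i j t u : ℤ) (hj : j ≤ n) (hij : i + 1 < j)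
    (ht : -i ≤ t) (ht' : t ≤ i) (hu : -j ≤ u) (hu' : u ≤ j) :
    eps2 n (Lam n i t) (Lam n j u) = 0 := by
  rw [eps2_eq_arrowWeight_sub]
  unfold Lam th
  rcases lt_trichotomy t 0 with h | h | h <;> rcases lt_trichotomy u 0 with h' | h' | h' <;>
    simp (disch := omega) only [if_pos, if_neg, arrowWeight_V_V, arrowWeight_V_C,
      arrowWeight_C_V, arrowWeight_C_C] <;>
    rfl

/-- A labelling by pairs `(i, r)` of vertices of the `𝒟ₙ`-quiver such that vertices in rows at
distance at least two are not connected, and consecutive rows are connected as in `rowEps`. -/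
structure RowLabelling (n : ℕ) (L : ℤ → ℤ → DnLabel) : Prop where
  valid : ∀ i t : ℤ, 1 ≤ i → i ≤ n → -i ≤ t → t ≤ i → (L i t).valid n
  eps2_succ : ∀ i t u : ℤ, 1 ≤ i → i < n → -i ≤ t → t ≤ i → -i - 1 ≤ u → u ≤ i + 1 →
    eps2 n (L i t) (L (i + 1) u) = rowEps i t u
  eps2_far : ∀ i j t u : ℤ, 1 ≤ i → j ≤ n → i + 1 < j → -i ≤ t → t ≤ i → -j ≤ u → u ≤ j →
    eps2 n (L i t) (L j u) = 0

theorem qq_ne_zero : qq ≠ 0 := RatFunc.X_ne_zero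

theorem ii_ne_zero : ii ≠ 0 := by
  simp [ii]

theorem qq_inv_ne_qq : qq⁻¹ ≠ qq := by
  intro h
  have h1 : qq * qq = 1 := (congrArg (qq * ·) h).symm.trans (mul_inv_cancel₀ qq_ne_zero)
  have h2 : (Polynomial.X * Polynomial.X : Polynomial ℂ) = 1 := by
    apply RatFunc.algebraMap_injective ℂ
    simpa [qq, RatFunc.algebraMap_X] using h1
  simpa using congrArg (Polynomial.eval 0) h2

theorem Xg_mul_Xg (n : ℕ) (u v : DnLabel) (hu : u.valid n) (hv : v.valid n) :
    Xg n u * Xg n v = qq ^ eps2 n v u • (Xg n v * Xg n u) := by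
  simp only [Xg, dif_pos hu, dif_pos hv, ← map_mul, ← map_smul]
  exact RingQuot.mkAlgHom_rel _ (DnRel.comm ⟨u, hu⟩ ⟨v, hv⟩)

theorem isUnit_Xg (n : ℕ) (v : DnLabel) : IsUnit (Xg n v) := by
  by_cases h : v.valid n
  · refine isUnit_iff_exists.2 ⟨Xinv n v, ?_, ?_⟩ <;>
      simp only [Xg, Xinv, dif_pos h, ← map_mul, ← map_one (RingQuot.mkAlgHom Kq (DnRel n))]
    · exact RingQuot.mkAlgHom_rel _ (DnRel.mul_inv ⟨v, h⟩)
    · exact RingQuot.mkAlgHom_rel _ (DnRel.inv_mul ⟨v, h⟩)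
  · simp [Xg, h]

section QCommutation

variable {K A : Type*} [Field K] [Ring A] [Algebra K A]

theorem list_prod_mul_of_qcomm {q : K} (hq : q ≠ 0) (y : ℕ → A) (x : A) (d : ℕ → ℤ) (m : ℕ)
    (hd : d 0 = 0) (h : ∀ k < m, y k * x = q ^ (d (k + 1) - d k) • (x * y k)) :
    ((List.range m).map y).prod * x = q ^ d m • (x * ((List.range m).map y).prod) := by
  induction m with
  | zero => simp [hd]
  | succ m ih =>
    rw [List.prod_range_succ, mul_assoc, h m (by omega), mul_smul_comm, ← mul_assoc,
      ih fun k hk => h k (by omega), smul_mul_assoc, smul_smul, ← zpow_add₀ hq, mul_assoc]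
    congr 2; ring

/-- If `y k` and `x j` `q`-commute with exponent the mixed second difference of `c`, then their
ordered products `q`-commute with exponent `c`. -/
theorem list_prod_mul_list_prod_of_qcomm {q : K} (hq : q ≠ 0) (x y : ℕ → A) (c : ℕ → ℕ → ℤ)
    (p m : ℕ) (hc : ∀ k, c 0 k = 0) (hc' : ∀ j, c j 0 = 0)
    (h : ∀ j < p, ∀ k < m, y k * x j =
      q ^ (c (j + 1) (k + 1) - c j (k + 1) - c (j + 1) k + c j k) • (x j * y k)) :
    ((List.range m).map y).prod * ((List.range p).map x).prod =
      q ^ c p m • (((List.range p).map x).prod * ((List.range m).map y).prod) := by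
  induction p with
  | zero => simp [hc]
  | succ p ih =>
    have h1 := list_prod_mul_of_qcomm hq y (x p) (fun k => c (p + 1) k - c p k) m (by simp [hc'])
      fun k hk => by rw [h p (by omega) k hk]; congr 2; ring
    rw [List.prod_range_succ, ← mul_assoc, ih fun j hj => h j (by omega), smul_mul_assoc,
      mul_assoc, h1, mul_smul_comm, smul_smul, ← zpow_add₀ hq, mul_assoc]
    congr 2; ring

/-- The elements `x` with `w x = c x w`. -/
def qCommutant (w : A) (c : K) : Submodule K A where
  carrier := {x | w * x = c • (x * w)}
  zero_mem' := by simp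
  add_mem' {x y} hx hy := by
    simp only [Set.mem_ofPred_eq] at hx hy ⊢
    rw [mul_add, add_mul, hx, hy, smul_add]
  smul_mem' a x hx := by
    simp only [Set.mem_ofPred_eq] at hx ⊢
    rw [mul_smul_comm, hx, smul_mul_assoc, smul_comm]

theorem mem_qCommutant {w : A} {c : K} {x : A} :
    x ∈ qCommutant w c ↔ w * x = c • (x * w) := Iff.rfl

theorem qCommutant_sup_mul_mem {w z x : A} {c d : K} (hz : Commute w z)
    (hx : x ∈ qCommutant w c ⊔ qCommutant w d) : x * z ∈ qCommutant w c ⊔ qCommutant w d := by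
  have h (e : K) (y : A) (hy : y ∈ qCommutant w e) : y * z ∈ qCommutant w e := by
    rw [mem_qCommutant] at hy ⊢
    rw [← mul_assoc, hy, smul_mul_assoc, mul_assoc, hz.eq, mul_assoc]
  obtain ⟨y, hy, y', hy', rfl⟩ := Submodule.mem_sup.1 hx
  rw [add_mul]
  exact Submodule.add_mem_sup (h c y hy) (h d y' hy')

theorem qCommutant_sup_mem_mul {w z x : A} {c d : K} (hz : Commute w z)
    (hx : x ∈ qCommutant w c ⊔ qCommutant w d) : z * x ∈ qCommutant w c ⊔ qCommutant w d := by
  have h (e : K) (y : A) (hy : y ∈ qCommutant w e) : z * y ∈ qCommutant w e := by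
    rw [mem_qCommutant] at hy ⊢
    rw [← mul_assoc, hz.eq, mul_assoc, hy, mul_smul_comm, mul_assoc]
  obtain ⟨y, hy, y', hy', rfl⟩ := Submodule.mem_sup.1 hx
  rw [mul_add]
  exact Submodule.add_mem_sup (h c y hy) (h d y' hy')

/-- Elements with different `q`-commutation factors past an invertible element are linearly
independent, so decompositions into such elements are unique. -/
theorem existsUnique_add_of_mem_qCommutant_sup {w x : A} {c d : K} (hw : IsUnit w) (hcd : c ≠ d)
    (hx : x ∈ qCommutant w c ⊔ qCommutant w d) :
    ∃! p : A × A, x = p.1 + p.2 ∧ w * p.1 = c • (p.1 * w) ∧ w * p.2 = d • (p.2 * w) := by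
  obtain ⟨y, hy, z, hz, rfl⟩ := Submodule.mem_sup.1 hx
  refine ⟨(y, z), ⟨rfl, hy, hz⟩, ?_⟩
  rintro ⟨y', z'⟩ ⟨h, hy', hz'⟩
  have h1 : y' - y = z - z' := by
    rw [sub_eq_sub_iff_add_eq_add, ← h, add_comm]
  have h2 : w * (y' - y) = c • ((y' - y) * w) := (qCommutant w c).sub_mem hy' hy
  have h3 : w * (z - z') = d • ((z - z') * w) := (qCommutant w d).sub_mem hz hz'
  rw [← h1, h2, ← sub_eq_zero, ← sub_smul] at h3
  have h4 : y' - y = 0 := by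
    have := (smul_eq_zero_iff_right (sub_ne_zero.2 hcd)).1 h3
    exact hw.mul_left_eq_zero.1 this
  exact Prod.ext (sub_eq_zero.1 h4) (sub_eq_zero.1 (h1.symm.trans h4)).symm

variable {w : A} {c d : K} {e G : ℕ → A}

theorem commute_of_commutator_recursion (h0 : G 0 = e 0)
    (hG : ∀ k, ∃ a b : K, G (k + 1) = a • (G k * e (k + 1)) + b • (e (k + 1) * G k)) (k : ℕ)
    (he : ∀ l ≤ k, Commute w (e l)) : Commute w (G k) := by
  induction k with
  | zero => rw [h0]; exact he 0 le_rfl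
  | succ k ih =>
    obtain ⟨a, b, h⟩ := hG k
    have h1 := ih fun l hl => he l (by omega)
    have h2 := he (k + 1) le_rfl
    rw [h]
    exact ((h1.mul_right h2).smul_right a).add_right ((h2.mul_right h1).smul_right b)

theorem mem_qCommutant_sup_of_last (h0 : G 0 = e 0)
    (hG : ∀ k, ∃ a b : K, G (k + 1) = a • (G k * e (k + 1)) + b • (e (k + 1) * G k)) (k : ℕ)
    (he : ∀ l < k, Commute w (e l)) (hk : e k ∈ qCommutant w c ⊔ qCommutant w d) :
    G k ∈ qCommutant w c ⊔ qCommutant w d := by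
  cases k with
  | zero => rwa [h0]
  | succ k =>
    obtain ⟨a, b, h⟩ := hG k
    have h1 := commute_of_commutator_recursion h0 hG k fun l hl => he l (by omega)
    rw [h]
    exact Submodule.add_mem _ (Submodule.smul_mem _ _ (qCommutant_sup_mem_mul h1 hk))
      (Submodule.smul_mem _ _ (qCommutant_sup_mul_mem h1 hk))

theorem mem_qCommutant_sup_of_first (h0 : G 0 = e 0)
    (hG : ∀ k, ∃ a b : K, G (k + 1) = a • (G k * e (k + 1)) + b • (e (k + 1) * G k)) (k : ℕ)
    (he : ∀ l, 1 ≤ l → l ≤ k → Commute w (e l)) (hk : e 0 ∈ qCommutant w c ⊔ qCommutant w d) :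
    G k ∈ qCommutant w c ⊔ qCommutant w d := by
  induction k with
  | zero => rwa [h0]
  | succ k ih =>
    obtain ⟨a, b, h⟩ := hG k
    have h1 := ih fun l hl hl' => he l hl (by omega)
    have h2 := he (k + 1) (by omega) le_rfl
    rw [h]
    exact Submodule.add_mem _ (Submodule.smul_mem _ _ (qCommutant_sup_mul_mem h2 h1))
      (Submodule.smul_mem _ _ (qCommutant_sup_mem_mul h2 h1))

end QCommutation

/-- The ordered product of the cluster variables in row `i` of a labelling, up to position `r`. -/
def rowProd (n : ℕ) (L : ℤ → ℤ → DnLabel) (i r : ℤ) : Dtorus n :=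
  ((List.range (r + i + 1).toNat).map fun k : ℕ => Xg n (L i (-i + k))).prod

/-- The normalised monomials: `w_i^r` for the labels `V_{i,r}` and `m_i^r` for `Λ_{i,r}`. -/
def rowMonomial (n : ℕ) (L : ℤ → ℤ → DnLabel) (i r : ℤ) : Dtorus n :=
  (ii * qq ^ (i + r)) • rowProd n L i r

/-- The sum of all the normalised monomials of row `i`. -/
def rowTotal (n : ℕ) (L : ℤ → ℤ → DnLabel) (i : ℤ) : Dtorus n :=
  ∑ r ∈ Finset.Icc (-i) (i - 1), rowMonomial n L i r

theorem isUnit_rowMonomial (n : ℕ) (L : ℤ → ℤ → DnLabel) (i r : ℤ) :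
    IsUnit (rowMonomial n L i r) := by
  have h : IsUnit (rowProd n L i r) := by
    refine List.prod_isUnit fun x hx => ?_
    obtain ⟨k, -, rfl⟩ := List.mem_map.1 hx
    exact isUnit_Xg _ _
  exact h.smul (Units.mk0 _ (mul_ne_zero ii_ne_zero (zpow_ne_zero _ qq_ne_zero)))

theorem rowMonomial_mem_qCommutant {n : ℕ} {L : ℤ → ℤ → DnLabel} {i r j s : ℤ} {c : Kq}
    (h : rowProd n L j s * rowProd n L i r = c • (rowProd n L i r * rowProd n L j s)) :
    rowMonomial n L i r ∈ qCommutant (rowMonomial n L j s) c := by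
  rw [mem_qCommutant, rowMonomial, rowMonomial, smul_mul_smul_comm, smul_mul_smul_comm, h,
    smul_comm, mul_comm (ii * qq ^ (j + s))]

theorem RowLabelling.rowProd_succ_mul {n : ℕ} {L : ℤ → ℤ → DnLabel} (hL : RowLabelling n L)
    {i r s : ℤ} (hi : 1 ≤ i) (hi' : i < n) (hr : -i ≤ r) (hr' : r < i) (hs : -i - 1 ≤ s)
    (hs' : s ≤ i) :
    rowProd n L (i + 1) s * rowProd n L i r =
      qq ^ rowSum i r s • (rowProd n L i r * rowProd n L (i + 1) s) := by
  have key := list_prod_mul_list_prod_of_qcomm qq_ne_zero (fun k : ℕ => Xg n (L i (-i + k)))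
    (fun k : ℕ => Xg n (L (i + 1) (-(i + 1) + k)))
    (fun j k => rowSum i (j - i - 1) (k - i - 2)) (r + i + 1).toNat (s + (i + 1) + 1).toNat
    (fun k => if_pos (by omega)) (fun j => if_pos (by omega)) ?_
  · refine key.trans ?_
    congr 3 <;> omega
  · intro j hj k hk
    rw [Xg_mul_Xg n _ _ (hL.valid _ _ (by omega) (by omega) (by omega) (by omega))
      (hL.valid _ _ hi hi'.le (by omega) (by omega)),
      hL.eps2_succ _ _ _ hi hi' (by omega) (by omega) (by omega) (by omega),
      rowEps_eq _ _ _ (by omega) (by omega) (by omega) (by omega)]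
    congr 2
    congr 1 <;> [congr 1; skip] <;> [congr 1; skip; skip] <;> congr 1 <;> push_cast <;> ring

theorem RowLabelling.rowProd_commute {n : ℕ} {L : ℤ → ℤ → DnLabel} (hL : RowLabelling n L)
    {i j r s : ℤ} (hi : 1 ≤ i) (hj : j ≤ n) (hij : i + 1 < j) (hr : r ≤ i) (hs : s ≤ j) :
    rowProd n L j s * rowProd n L i r = (1 : Kq) • (rowProd n L i r * rowProd n L j s) := by
  refine (list_prod_mul_list_prod_of_qcomm qq_ne_zero (fun k : ℕ => Xg n (L i (-i + k)))
    (fun k : ℕ => Xg n (L j (-j + k))) (fun _ _ => 0) (r + i + 1).toNat (s + j + 1).toNat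
    (fun k => rfl) (fun j => rfl) ?_).trans (by rw [zpow_zero]; rfl)
  intro a ha b hb
  rw [Xg_mul_Xg n _ _ (hL.valid _ _ (by omega) (by omega) (by omega) (by omega))
    (hL.valid _ _ hi (by omega) (by omega) (by omega)),
    hL.eps2_far _ _ _ _ hi hj hij (by omega) (by omega) (by omega) (by omega)]
  rfl

theorem qCommutant_symm {K A : Type*} [Field K] [Ring A] [Algebra K A] {w x : A} {c : K}
    (hc : c ≠ 0) (h : x ∈ qCommutant w c) : w ∈ qCommutant x c⁻¹ := by
  rw [mem_qCommutant] at h ⊢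
  rw [h, smul_smul, inv_mul_cancel₀ hc, one_smul]

theorem RowLabelling.rowTotal_mem {n : ℕ} {L : ℤ → ℤ → DnLabel} (hL : RowLabelling n L)
    {i j s : ℤ} (hi : 1 ≤ i) (hi' : i ≤ n) (hj : 1 ≤ j) (hj' : j ≤ n) (hij : j = i + 1 ∨ i = j + 1)
    (hs : -j ≤ s) (hs' : s < j) :
    rowTotal n L i ∈ qCommutant (rowMonomial n L j s) qq⁻¹ ⊔ qCommutant (rowMonomial n L j s) qq := by
  have hor (a b c : ℤ) (h : -a ≤ b) (h' : -a - 1 ≤ c) : rowSum a b c = 1 ∨ rowSum a b c = -1 := by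
    unfold rowSum
    rw [if_neg (by omega)]
    exact ite_eq_or_eq _ _ _
  refine Submodule.sum_mem _ fun r hr => ?_
  rw [Finset.mem_Icc] at hr
  rcases hij with rfl | rfl
  · have h := rowMonomial_mem_qCommutant
      (hL.rowProd_succ_mul hi (by omega) hr.1 (by omega) (by omega) (by omega) (s := s))
    rcases hor i r s (by omega) (by omega) with h' | h' <;> rw [h'] at h
    · exact Submodule.mem_sup_right (by simpa using h)
    · exact Submodule.mem_sup_left (by simpa using h)
  · have h := qCommutant_symm (zpow_ne_zero _ qq_ne_zero) (rowMonomial_mem_qCommutant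
      (hL.rowProd_succ_mul hj (by omega) hs (by omega) (by omega) (by omega) (s := r)))
    rcases hor j s r (by omega) (by omega) with h' | h' <;> rw [h'] at h
    · exact Submodule.mem_sup_left (by simpa using h)
    · exact Submodule.mem_sup_right (by simpa using h)

theorem RowLabelling.commute_rowTotal {n : ℕ} {L : ℤ → ℤ → DnLabel} (hL : RowLabelling n L)
    {i j s : ℤ} (hi : 1 ≤ i) (hi' : i ≤ n) (hj : 1 ≤ j) (hj' : j ≤ n)
    (hij : i + 1 < j ∨ j + 1 < i) (hs' : s < j) :
    Commute (rowMonomial n L j s) (rowTotal n L i) := by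
  refine Commute.sum_right _ _ _ fun r hr => ?_
  rw [Finset.mem_Icc] at hr
  rcases hij with hij | hij
  · have h := rowMonomial_mem_qCommutant
      (hL.rowProd_commute hi hj' hij (by omega) (by omega) (r := r) (s := s))
    rw [mem_qCommutant, one_smul] at h
    exact h
  · have h := rowMonomial_mem_qCommutant
      (hL.rowProd_commute hj hi' hij (by omega) (by omega) (r := s) (s := r))
    rw [mem_qCommutant, one_smul] at h
    exact h.symm

theorem rowLabelling_V (n : ℕ) : RowLabelling n DnLabel.V where
  valid _ _ h1 h2 h3 h4 := ⟨h1, h2, h3, h4⟩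
  eps2_succ i t u h1 h2 h3 h4 _ _ := eps2_V_V_succ n i t u h1 h2 h3 h4
  eps2_far i j t u _ _ h _ _ _ _ := eps2_V_V_far n i j t u h

theorem rowLabelling_Lam (n : ℕ) : RowLabelling n (Lam n) where
  valid i t h1 h2 h3 h4 := by
    unfold Lam th
    split_ifs <;> simp only [DnLabel.valid] <;> omega
  eps2_succ := eps2_Lam_Lam_succ n
  eps2_far i j t u _ := eps2_Lam_Lam_far n i j t u

theorem ww_eq_rowMonomial (n : ℕ) (i r : ℤ) : ww n i r = rowMonomial n DnLabel.V i r := by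
  simp only [ww, Vprod, rowMonomial, rowProd, List.bind_pure_natCast, List.map_map,
    Function.comp_def]

theorem mm_eq_rowMonomial (n : ℕ) (i r : ℤ) : mm n i r = rowMonomial n (Lam n) i r := by
  simp only [mm, Lprod, rowMonomial, rowProd, List.bind_pure_natCast, List.map_map,
    Function.comp_def]

theorem Ev_eq_rowTotal (n : ℕ) (i : ℤ) : Ev n i = rowTotal n DnLabel.V i := by
  simp only [Ev, rowTotal, ww_eq_rowMonomial]

theorem Fv_eq_rowTotal (n : ℕ) (i : ℤ) : Fv n i = rowTotal n (Lam n) (th n i) := by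
  simp only [Fv, rowTotal, mm_eq_rowMonomial]

theorem EEaux_succ (n : ℕ) (i : ℤ) (k : ℕ) : ∃ a b : Kq,
    EEaux n i (k + 1) = a • (EEaux n i k * Ev n (i + (k + 1 : ℕ)))
      + b • (Ev n (i + (k + 1 : ℕ)) * EEaux n i k) := by
  refine ⟨(qq - qq⁻¹)⁻¹, -((qq - qq⁻¹)⁻¹ * qq), ?_⟩
  rw [EEaux, smul_sub, smul_smul, sub_eq_add_neg, Nat.cast_succ, ← add_assoc]
  exact congrArg (_ + ·) (neg_smul _ _).symm

theorem FFaux_succ (n : ℕ) (i : ℤ) (k : ℕ) : ∃ a b : Kq,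
    FFaux n i (k + 1) = a • (FFaux n i k * Fv n (i + (k + 1 : ℕ)))
      + b • (Fv n (i + (k + 1 : ℕ)) * FFaux n i k) := by
  refine ⟨-((qq - qq⁻¹)⁻¹ * qq⁻¹), (qq - qq⁻¹)⁻¹, ?_⟩
  rw [FFaux, smul_sub, smul_smul, sub_eq_neg_add, Nat.cast_succ, ← add_assoc]
  exact congrArg (· + _) (neg_smul _ _).symm

/-- Existence and uniqueness of the decompositions
`E_{i,j} = E_{i,j}^{↑s_−} + E_{i,j}^{↑s_+}` with `w_{j+1}^s E_{i,j}^{↑s_±} = q^{±1} E_{i,j}^{↑s_±} w_{j+1}^s`,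
and the three analogous decompositions `E^{↓r_±}`, `F^{↑s_±}`, `F^{↓r_±}`. -/
theorem statement8 (n : ℕ) (hn : 1 ≤ n) :
    -- (a)
    (∀ i j s : ℤ, 1 ≤ i → i ≤ j → j < (n : ℤ) → -(j + 1) ≤ s → s ≤ j →
      ∃! p : Dtorus n × Dtorus n,
        EE n i j = p.1 + p.2 ∧
        ww n (j + 1) s * p.1 = qq⁻¹ • (p.1 * ww n (j + 1) s) ∧
        ww n (j + 1) s * p.2 = qq • (p.2 * ww n (j + 1) s)) ∧
    -- (b)
    (∀ i j r : ℤ, 1 < i → i ≤ j → j ≤ (n : ℤ) → -(i - 1) ≤ r → r ≤ i - 2 →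
      ∃! p : Dtorus n × Dtorus n,
        EE n i j = p.1 + p.2 ∧
        ww n (i - 1) r * p.1 = qq⁻¹ • (p.1 * ww n (i - 1) r) ∧
        ww n (i - 1) r * p.2 = qq • (p.2 * ww n (i - 1) r)) ∧
    -- (c)
    (∀ i j s : ℤ, 1 ≤ i → i ≤ j → j < (n : ℤ) → -(th n (j + 1)) ≤ s → s ≤ th n (j + 1) - 1 →
      ∃! p : Dtorus n × Dtorus n,
        FF n i j = p.1 + p.2 ∧
        mm n (th n (j + 1)) s * p.1 = qq⁻¹ • (p.1 * mm n (th n (j + 1)) s) ∧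
        mm n (th n (j + 1)) s * p.2 = qq • (p.2 * mm n (th n (j + 1)) s)) ∧
    -- (d)
    (∀ i j r : ℤ, 1 < i → i ≤ j → j ≤ (n : ℤ) → -(th n (i - 1)) ≤ r → r ≤ th n (i - 1) - 1 →
      ∃! p : Dtorus n × Dtorus n,
        FF n i j = p.1 + p.2 ∧
        mm n (th n (i - 1)) r * p.1 = qq⁻¹ • (p.1 * mm n (th n (i - 1)) r) ∧
        mm n (th n (i - 1)) r * p.2 = qq • (p.2 * mm n (th n (i - 1)) r)) := by
  refine ⟨fun i j s hi hij hj hs hs' => ?_, fun i j r hi hij hj hr hr' => ?_,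
    fun i j s hi hij hj hs hs' => ?_, fun i j r hi hij hj hr hr' => ?_⟩
  · rw [ww_eq_rowMonomial]
    refine existsUnique_add_of_mem_qCommutant_sup (isUnit_rowMonomial _ _ _ _) qq_inv_ne_qq
      (mem_qCommutant_sup_of_last (e := fun l : ℕ => Ev n (i + l)) (by simp [EEaux])
        (EEaux_succ n i) _ (fun l hl => ?_) ?_) <;> rw [Ev_eq_rowTotal]
    · exact (rowLabelling_V n).commute_rowTotal (by omega) (by omega) (by omega) (by omega)
        (by omega) (by omega)
    · exact (rowLabelling_V n).rowTotal_mem (by omega) (by omega) (by omega) (by omega)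
        (by omega) (by omega) (by omega)
  · rw [ww_eq_rowMonomial]
    refine existsUnique_add_of_mem_qCommutant_sup (isUnit_rowMonomial _ _ _ _) qq_inv_ne_qq
      (mem_qCommutant_sup_of_first (e := fun l : ℕ => Ev n (i + l)) (by simp [EEaux])
        (EEaux_succ n i) _ (fun l hl hl' => ?_) ?_) <;> rw [Ev_eq_rowTotal]
    · exact (rowLabelling_V n).commute_rowTotal (by omega) (by omega) (by omega) (by omega)
        (by omega) (by omega)
    · exact (rowLabelling_V n).rowTotal_mem (by omega) (by omega) (by omega) (by omega)
        (by omega) (by omega) (by omega)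
  · rw [mm_eq_rowMonomial]
    refine existsUnique_add_of_mem_qCommutant_sup (isUnit_rowMonomial _ _ _ _) qq_inv_ne_qq
      (mem_qCommutant_sup_of_last (e := fun l : ℕ => Fv n (i + l)) (by simp [FFaux])
        (FFaux_succ n i) _ (fun l hl => ?_) ?_) <;> rw [Fv_eq_rowTotal] <;> unfold th at *
    · exact (rowLabelling_Lam n).commute_rowTotal (by omega) (by omega) (by omega) (by omega)
        (by omega) (by omega)
    · exact (rowLabelling_Lam n).rowTotal_mem (by omega) (by omega) (by omega) (by omega)
        (by omega) (by omega) (by omega)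
  · rw [mm_eq_rowMonomial]
    refine existsUnique_add_of_mem_qCommutant_sup (isUnit_rowMonomial _ _ _ _) qq_inv_ne_qq
      (mem_qCommutant_sup_of_first (e := fun l : ℕ => Fv n (i + l)) (by simp [FFaux])
        (FFaux_succ n i) _ (fun l hl hl' => ?_) ?_) <;> rw [Fv_eq_rowTotal] <;> unfold th at *
    · exact (rowLabelling_Lam n).commute_rowTotal (by omega) (by omega) (by omega) (by omega)
        (by omega) (by omega)
    · exact (rowLabelling_Lam n).rowTotal_mem (by omega) (by omega) (by omega) (by omega)
        (by omega) (by omega) (by omega)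

end
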